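/- Let p(x,y,z) and q(x,y,z) be linearly independent homogeneous polynomials of degree 2 over ℂ. Suppose there exist four vectors (αᵢ, βᵢ) ∈ ℂ², i = 1,…,4, that are pairwise noncollinear, such that each polynomial rᵢ = αᵢ·p + βᵢ·q is factorizable (a product of two homogeneous linear polynomials). Then at least one of the following conditions holds: (a) p and q have a common linear factor, i.e., p = ℓ·ℓ₁ and q = ℓ·ℓ₂ for homogeneous linear polynomials ℓ, ℓ₁, ℓ₂; (b) there exist homogeneous linear polynomials s, t in x, y, z and bivariate homogeneous polynomials f, g of degree 2 such that p = f(s,t) and q = g(s,t). Consequently, for every (α, β) ∈ ℂ², the polynomial r = α·p + β·q is factorizable. -/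

import Mathlib

open MvPolynomial

/-- A trivariate homogeneous polynomial of degree 2 is *factorizable* if it can be
written as a product of two homogeneous polynomials of degree 1 (linear forms). -/
def Factorizable3 (r : MvPolynomial (Fin 3) ℂ) : Prop :=
  ∃ ℓ₁ ℓ₂ : MvPolynomial (Fin 3) ℂ,
    ℓ₁.IsHomogeneous 1 ∧ ℓ₂.IsHomogeneous 1 ∧ r = ℓ₁ * ℓ₂

/-- The linear form with coefficient vector `L`. -/
noncomputable def linearForm : (Fin 3 → ℂ) →ₗ[ℂ] MvPolynomial (Fin 3) ℂ :=
  Fintype.linearCombination ℂ X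

lemma eval_linearForm (P L : Fin 3 → ℂ) : eval P (linearForm L) = L ⬝ᵥ P := by
  simp [linearForm, Fintype.linearCombination_apply, dotProduct, smul_eval]

lemma MvPolynomial.IsHomogeneous.smul_complex {σ : Type*} {p : MvPolynomial σ ℂ} {n : ℕ}
    (hp : p.IsHomogeneous n) (c : ℂ) : (c • p).IsHomogeneous n :=
  (homogeneousSubmodule σ ℂ n).smul_mem c hp

lemma exists_eq_linearForm {ℓ : MvPolynomial (Fin 3) ℂ} (h : ℓ.IsHomogeneous 1) :
    ∃ L, ℓ = linearForm L := by
  have h' : ℓ ∈ homogeneousSubmodule (Fin 3) ℂ 1 := h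
  rw [homogeneousSubmodule_one_eq_span_X, ← Fintype.range_linearCombination] at h'
  obtain ⟨L, hL⟩ := h'
  exact ⟨L, hL.symm⟩

lemma isHomogeneous_linearForm (L : Fin 3 → ℂ) : (linearForm L).IsHomogeneous 1 := by
  have h : linearForm L ∈ homogeneousSubmodule (Fin 3) ℂ 1 := by
    rw [homogeneousSubmodule_one_eq_span_X, ← Fintype.range_linearCombination]
    exact ⟨L, rfl⟩
  exact h

lemma exists_det_ne_zero {A B : Fin 3 → ℂ} (h : LinearIndependent ℂ ![A, B]) :
    ∃ C : Fin 3 → ℂ, (Matrix.of ![A, B, C]).det ≠ 0 := by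
  by_contra! H
  have hAB : crossProduct A B = 0 := by
    refine dotProduct_eq_zero _ fun C => ?_
    rw [dotProduct_comm, triple_product_permutation, triple_product_eq_det]
    exact H C
  rw [LinearIndependent.pair_iff] at h
  have h0 := congrFun hAB 0
  have h1 := congrFun hAB 1
  have h2 := congrFun hAB 2
  simp only [cross_apply, Matrix.cons_val, Pi.zero_apply] at h0 h1 h2
  have hA : ∀ i, A i = 0 := fun i => by
    have := (h (B i) (-A i) (by
      ext j
      fin_cases i <;> fin_cases j <;> simp <;> grind)).2
    simpa using this
  have := (h 1 0 (by ext j; simp [hA])).1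
  simp at this

/-- Two independent linear forms in three variables extend to a system of coordinates. -/
lemma exists_coordinates {a b : MvPolynomial (Fin 3) ℂ} (ha : a.IsHomogeneous 1)
    (hb : b.IsHomogeneous 1) (hab : LinearIndependent ℂ ![a, b]) :
    ∃ c : MvPolynomial (Fin 3) ℂ, c.IsHomogeneous 1 ∧
      (∀ ℓ : MvPolynomial (Fin 3) ℂ, ℓ.IsHomogeneous 1 →
        ∃ x y z : ℂ, ℓ = x • a + y • b + z • c) ∧
      ∀ x y z : ℂ, ∃ P, eval P a = x ∧ eval P b = y ∧ eval P c = z := by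
  obtain ⟨A, rfl⟩ := exists_eq_linearForm ha
  obtain ⟨B, rfl⟩ := exists_eq_linearForm hb
  have hAB : LinearIndependent ℂ ![A, B] := by
    refine LinearIndependent.of_comp linearForm ?_
    convert hab using 1
    ext i : 1
    fin_cases i <;> rfl
  obtain ⟨C, hC⟩ := exists_det_ne_zero hAB
  set M := Matrix.of ![A, B, C] with hM
  have hu : IsUnit M.det := isUnit_iff_ne_zero.mpr hC
  refine ⟨linearForm C, isHomogeneous_linearForm C, fun ℓ hℓ => ?_, fun x y z => ?_⟩
  · obtain ⟨L, rfl⟩ := exists_eq_linearForm hℓ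
    have hL : Matrix.vecMul (Matrix.vecMul L M⁻¹) M = L := by
      rw [Matrix.vecMul_vecMul, Matrix.nonsing_inv_mul _ hu, Matrix.vecMul_one]
    set k := Matrix.vecMul L M⁻¹
    refine ⟨k 0, k 1, k 2, ?_⟩
    rw [← map_smul, ← map_smul, ← map_smul, ← map_add, ← map_add]
    congr 1
    rw [← hL]
    ext j
    simp [Matrix.vecMul, dotProduct, Fin.sum_univ_three, hM]
  · have hP : M.mulVec (M⁻¹.mulVec ![x, y, z]) = ![x, y, z] := by
      rw [Matrix.mulVec_mulVec, Matrix.mul_nonsing_inv _ hu, Matrix.one_mulVec]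
    refine ⟨M⁻¹.mulVec ![x, y, z], ?_, ?_, ?_⟩ <;> rw [eval_linearForm]
    · exact congrFun hP 0
    · exact congrFun hP 1
    · exact congrFun hP 2

/-- A pair of ternary quadratic forms sharing a linear factor, or both depending only on the
same two linear forms. -/
def IsDegeneratePair (p q : MvPolynomial (Fin 3) ℂ) : Prop :=
  (∃ ℓ ℓ₁ ℓ₂ : MvPolynomial (Fin 3) ℂ,
    ℓ.IsHomogeneous 1 ∧ ℓ₁.IsHomogeneous 1 ∧ ℓ₂.IsHomogeneous 1 ∧
    p = ℓ * ℓ₁ ∧ q = ℓ * ℓ₂) ∨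
  ∃ s t : MvPolynomial (Fin 3) ℂ, s.IsHomogeneous 1 ∧ t.IsHomogeneous 1 ∧
    (∃ A B C : ℂ, p = A • s ^ 2 + B • (s * t) + C • t ^ 2) ∧
    ∃ A B C : ℂ, q = A • s ^ 2 + B • (s * t) + C • t ^ 2

lemma IsDegeneratePair.combination {p q : MvPolynomial (Fin 3) ℂ} (h : IsDegeneratePair p q)
    (x y z w : ℂ) : IsDegeneratePair (x • p + y • q) (z • p + w • q) := by
  rcases h with ⟨ℓ, ℓ₁, ℓ₂, h, h₁, h₂, rfl, rfl⟩ |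
    ⟨s, t, hs, ht, ⟨A, B, C, rfl⟩, A', B', C', rfl⟩
  · exact Or.inl ⟨ℓ, x • ℓ₁ + y • ℓ₂, z • ℓ₁ + w • ℓ₂, h,
      (h₁.smul_complex x).add (h₂.smul_complex y), (h₁.smul_complex z).add (h₂.smul_complex w),
      by simp only [smul_eq_C_mul]; ring, by simp only [smul_eq_C_mul]; ring⟩
  · refine Or.inr ⟨s, t, hs, ht, ⟨x * A + y * A', x * B + y * B', x * C + y * C', ?_⟩,
      z * A + w * A', z * B + w * B', z * C + w * C', ?_⟩ <;> module

/-- Over `ℂ` a binary quadratic form in two linear forms splits. -/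
lemma factorizable3_binary {s t : MvPolynomial (Fin 3) ℂ} (hs : s.IsHomogeneous 1)
    (ht : t.IsHomogeneous 1) (A B D : ℂ) :
    Factorizable3 (A • s ^ 2 + B • (s * t) + D • t ^ 2) := by
  rcases eq_or_ne A 0 with rfl | hA
  · exact ⟨t, B • s + D • t, ht, (hs.smul_complex B).add (ht.smul_complex D),
      by simp only [smul_eq_C_mul, C_0]; ring⟩
  · obtain ⟨δ, hδ⟩ := IsAlgClosed.exists_pow_nat_eq (B ^ 2 - 4 * A * D) (n := 2) two_pos
    refine ⟨A • s + ((B - δ) / 2) • t, s + ((B + δ) / (2 * A)) • t,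
      (hs.smul_complex _).add (ht.smul_complex _), hs.add (ht.smul_complex _), ?_⟩
    have hB : B = (B - δ) / 2 + A * ((B + δ) / (2 * A)) := by field_simp; ring
    have hD : D = (B - δ) / 2 * ((B + δ) / (2 * A)) := by
      field_simp
      linear_combination hδ
    generalize (B - δ) / 2 = u at *
    generalize (B + δ) / (2 * A) = w at *
    subst hD
    rw [hB]
    simp only [smul_eq_C_mul, C_add, C_mul]
    ring

lemma IsDegeneratePair.factorizable3 {p q : MvPolynomial (Fin 3) ℂ} (h : IsDegeneratePair p q)
    (α β : ℂ) : Factorizable3 (α • p + β • q) := by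
  rcases h.combination α β α β with ⟨ℓ, ℓ₁, -, h, h₁, -, e, -⟩ | ⟨s, t, hs, ht, ⟨A, B, C, e⟩, -⟩
  · exact ⟨ℓ, ℓ₁, h, h₁, e⟩
  · rw [e]
    exact factorizable3_binary hs ht A B C

/-- The determinant of a product of two linear forms vanishes, in arbitrary coordinates. -/
lemma Factorizable3.disc_eq_zero {a b c : MvPolynomial (Fin 3) ℂ}
    (hP : ∀ x y z : ℂ, ∃ P, eval P a = x ∧ eval P b = y ∧ eval P c = z)
    (hspan : ∀ ℓ : MvPolynomial (Fin 3) ℂ, ℓ.IsHomogeneous 1 →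
      ∃ x y z : ℂ, ℓ = x • a + y • b + z • c)
    {A B C D E F : ℂ}
    (h : Factorizable3 (A • a ^ 2 + B • b ^ 2 + C • c ^ 2 + D • (a * b) + E • (a * c)
      + F • (b * c))) :
    4 * A * B * C + D * E * F - A * F ^ 2 - B * E ^ 2 - C * D ^ 2 = 0 := by
  obtain ⟨ℓ, m, hℓ, hm, e⟩ := h
  obtain ⟨l₁, l₂, l₃, rfl⟩ := hspan ℓ hℓ
  obtain ⟨m₁, m₂, m₃, rfl⟩ := hspan m hm
  have key : ∀ x y z : ℂ, A * x ^ 2 + B * y ^ 2 + C * z ^ 2 + D * (x * y) + E * (x * z)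
      + F * (y * z) = (l₁ * x + l₂ * y + l₃ * z) * (m₁ * x + m₂ * y + m₃ * z) := fun x y z => by
    obtain ⟨P, rfl, rfl, rfl⟩ := hP x y z
    simpa [smul_eval] using congrArg (eval P) e
  have hA : A = l₁ * m₁ := by linear_combination key 1 0 0
  have hB : B = l₂ * m₂ := by linear_combination key 0 1 0
  have hC : C = l₃ * m₃ := by linear_combination key 0 0 1
  have hD : D = l₁ * m₂ + l₂ * m₁ := by linear_combination key 1 1 0 - hA - hB
  have hE : E = l₁ * m₃ + l₃ * m₁ := by linear_combination key 1 0 1 - hA - hC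
  have hF : F = l₂ * m₃ + l₃ * m₂ := by linear_combination key 0 1 1 - hB - hC
  subst hA hB hC hD hE hF
  ring

lemma isDegeneratePair_of_linearIndependent {a b s : MvPolynomial (Fin 3) ℂ}
    (ha : a.IsHomogeneous 1) (hb : b.IsHomogeneous 1) (hab : LinearIndependent ℂ ![a, b])
    (hs : Factorizable3 s) {x y z w : ℂ} (hx : x ≠ 0) (hy : y ≠ 0) (hz : z ≠ 0) (hw : w ≠ 0)
    (hdet : x * w - z * y ≠ 0) (h₁ : Factorizable3 (x • (a * b) + y • s))
    (h₂ : Factorizable3 (z • (a * b) + w • s)) : IsDegeneratePair (a * b) s := by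
  obtain ⟨c, hc, hspan, hP⟩ := exists_coordinates ha hb hab
  obtain ⟨A, B, C, D, E, F, rfl⟩ : ∃ A B C D E F : ℂ, s = A • a ^ 2 + B • b ^ 2 + C • c ^ 2
      + D • (a * b) + E • (a * c) + F • (b * c) := by
    obtain ⟨ℓ, m, hℓ, hm, rfl⟩ := hs
    obtain ⟨l₁, l₂, l₃, rfl⟩ := hspan ℓ hℓ
    obtain ⟨m₁, m₂, m₃, rfl⟩ := hspan m hm
    refine ⟨l₁ * m₁, l₂ * m₂, l₃ * m₃, l₁ * m₂ + l₂ * m₁, l₁ * m₃ + l₃ * m₁,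
      l₂ * m₃ + l₃ * m₂, ?_⟩
    simp only [smul_eq_C_mul, C_add, C_mul]
    ring
  have hK := hs.disc_eq_zero hP hspan
  have disc : ∀ u v : ℂ, u ≠ 0 → v ≠ 0 → Factorizable3 (u • (a * b) + v • (A • a ^ 2 + B • b ^ 2
      + C • c ^ 2 + D • (a * b) + E • (a * c) + F • (b * c))) →
      C * u + (2 * C * D - E * F) * v = 0 := fun u v hu hv h => by
    have h' : Factorizable3 ((v * A) • a ^ 2 + (v * B) • b ^ 2 + (v * C) • c ^ 2
        + (u + v * D) • (a * b) + (v * E) • (a * c) + (v * F) • (b * c)) := by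
      convert h using 1
      module
    have := h'.disc_eq_zero hP hspan
    refine (mul_eq_zero.mp ?_).resolve_left (mul_ne_zero hu hv)
    linear_combination v ^ 3 * hK - this
  have e₁ := disc x y hx hy h₁
  have e₂ := disc z w hz hw h₂
  have hC : C = 0 := by
    refine (mul_eq_zero.mp ?_).resolve_left hdet
    linear_combination w * e₁ - y * e₂
  subst hC
  have hEF : E * F = 0 := by
    refine (mul_eq_zero.mp ?_).resolve_left hy
    linear_combination -e₁
  rcases mul_eq_zero.mp hEF with rfl | rfl
  · rcases eq_or_ne F 0 with rfl | hF
    · exact Or.inr ⟨a, b, ha, hb, ⟨0, 1, 0, by module⟩, A, D, B, by module⟩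
    · have hA : A = 0 := by
        refine (mul_eq_zero.mp ?_).resolve_right (pow_ne_zero 2 hF)
        linear_combination -hK
      subst hA
      exact Or.inl ⟨b, a, B • b + D • a + F • c, hb, ha,
        ((hb.smul_complex _).add (ha.smul_complex _)).add (hc.smul_complex _), mul_comm a b,
        by simp only [smul_eq_C_mul, C_0]; ring⟩
  · rcases eq_or_ne E 0 with rfl | hE
    · exact Or.inr ⟨a, b, ha, hb, ⟨0, 1, 0, by module⟩, A, D, B, by module⟩
    · have hB : B = 0 := by
        refine (mul_eq_zero.mp ?_).resolve_right (pow_ne_zero 2 hE)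
        linear_combination -hK
      subst hB
      exact Or.inl ⟨a, b, A • a + D • b + E • c, ha, hb,
        ((ha.smul_complex _).add (hb.smul_complex _)).add (hc.smul_complex _), rfl,
        by simp only [smul_eq_C_mul, C_0]; ring⟩

lemma mul_eq_smul_sq_of_not_linearIndependent {a b : MvPolynomial (Fin 3) ℂ}
    (h : ¬ LinearIndependent ℂ ![a, b]) : ∃ k : ℂ, a * b = k • a ^ 2 := by
  rcases eq_or_ne a 0 with rfl | ha
  · exact ⟨0, by simp⟩
  · rw [LinearIndependent.pair_iff' ha] at h
    push Not at h
    obtain ⟨k, rfl⟩ := h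
    exact ⟨k, by simp [sq]⟩

lemma isDegeneratePair_of_linearIndependent_factors {p q a b : MvPolynomial (Fin 3) ℂ}
    {v₁ v₂ v₃ v₄ : ℂ × ℂ} (h₁₂ : v₁.1 * v₂.2 - v₂.1 * v₁.2 ≠ 0)
    (h₁₃ : v₁.1 * v₃.2 - v₃.1 * v₁.2 ≠ 0) (h₁₄ : v₁.1 * v₄.2 - v₄.1 * v₁.2 ≠ 0)
    (h₂₃ : v₂.1 * v₃.2 - v₃.1 * v₂.2 ≠ 0) (h₂₄ : v₂.1 * v₄.2 - v₄.1 * v₂.2 ≠ 0)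
    (h₃₄ : v₃.1 * v₄.2 - v₄.1 * v₃.2 ≠ 0)
    (ha : a.IsHomogeneous 1) (hb : b.IsHomogeneous 1) (hab : LinearIndependent ℂ ![a, b])
    (e₁ : v₁.1 • p + v₁.2 • q = a * b) (f₂ : Factorizable3 (v₂.1 • p + v₂.2 • q))
    (f₃ : Factorizable3 (v₃.1 • p + v₃.2 • q)) (f₄ : Factorizable3 (v₄.1 • p + v₄.2 • q)) :
    IsDegeneratePair (v₁.1 • p + v₁.2 • q) (v₂.1 • p + v₂.2 • q) := by
  have key : ∀ v : ℂ × ℂ, Factorizable3 (v.1 • p + v.2 • q) →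
      Factorizable3 ((-(v₂.1 * v.2 - v.1 * v₂.2)) • (a * b)
        + (v₁.1 * v.2 - v.1 * v₁.2) • (v₂.1 • p + v₂.2 • q)) := by
    rintro v ⟨ℓ, m, hℓ, hm, e⟩
    refine ⟨(v₁.1 * v₂.2 - v₂.1 * v₁.2) • ℓ, m, hℓ.smul_complex _, hm, ?_⟩
    rw [smul_mul_assoc, ← e, ← e₁]
    module
  rw [e₁]
  refine isDegeneratePair_of_linearIndependent ha hb hab f₂ (neg_ne_zero.mpr h₂₃) h₁₃
    (neg_ne_zero.mpr h₂₄) h₁₄ ?_ (key v₃ f₃) (key v₄ f₄)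
  convert mul_ne_zero h₁₂ h₃₄ using 1
  ring

lemma IsDegeneratePair.of_combination {p q : MvPolynomial (Fin 3) ℂ} {v w : ℂ × ℂ}
    (hd : v.1 * w.2 - w.1 * v.2 ≠ 0)
    (h : IsDegeneratePair (v.1 • p + v.2 • q) (w.1 • p + w.2 • q)) : IsDegeneratePair p q := by
  set d := v.1 * w.2 - w.1 * v.2 with hd'
  have hp : p = (d⁻¹ * w.2) • (v.1 • p + v.2 • q) + (-d⁻¹ * v.2) • (w.1 • p + w.2 • q) := by
    trans (d⁻¹ * d) • p
    · rw [inv_mul_cancel₀ hd, one_smul]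
    · rw [hd']; module
  have hq : q = (-d⁻¹ * w.1) • (v.1 • p + v.2 • q) + (d⁻¹ * v.1) • (w.1 • p + w.2 • q) := by
    trans (d⁻¹ * d) • q
    · rw [inv_mul_cancel₀ hd, one_smul]
    · rw [hd']; module
  have := h.combination (d⁻¹ * w.2) (-d⁻¹ * v.2) (-d⁻¹ * w.1) (d⁻¹ * v.1)
  rwa [← hp, ← hq] at this

lemma isDegeneratePair_of_four_factorizable {p q : MvPolynomial (Fin 3) ℂ} {v : Fin 4 → ℂ × ℂ}
    (hnc : ∀ i j, i ≠ j → (v i).1 * (v j).2 - (v j).1 * (v i).2 ≠ 0)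
    (hfac : ∀ i, Factorizable3 ((v i).1 • p + (v i).2 • q)) : IsDegeneratePair p q := by
  obtain ⟨a, b, ha, hb, e₀⟩ := hfac 0
  obtain ⟨c, d, hc, hd, e₁⟩ := hfac 1
  by_cases hab : LinearIndependent ℂ ![a, b]
  · exact (isDegeneratePair_of_linearIndependent_factors (hnc 0 1 (by decide))
      (hnc 0 2 (by decide)) (hnc 0 3 (by decide)) (hnc 1 2 (by decide)) (hnc 1 3 (by decide))
      (hnc 2 3 (by decide)) ha hb hab e₀ (hfac 1) (hfac 2) (hfac 3)).of_combination
      (hnc 0 1 (by decide))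
  by_cases hcd : LinearIndependent ℂ ![c, d]
  · exact (isDegeneratePair_of_linearIndependent_factors (hnc 1 0 (by decide))
      (hnc 1 2 (by decide)) (hnc 1 3 (by decide)) (hnc 0 2 (by decide)) (hnc 0 3 (by decide))
      (hnc 2 3 (by decide)) hc hd hcd e₁ (hfac 0) (hfac 2) (hfac 3)).of_combination
      (hnc 1 0 (by decide))
  refine IsDegeneratePair.of_combination (hnc 0 1 (by decide)) (Or.inr ⟨a, c, ha, hc, ?_, ?_⟩)
  · obtain ⟨k, hk⟩ := mul_eq_smul_sq_of_not_linearIndependent hab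
    exact ⟨k, 0, 0, by rw [e₀, hk]; module⟩
  · obtain ⟨k, hk⟩ := mul_eq_smul_sq_of_not_linearIndependent hcd
    exact ⟨0, 0, k, by rw [e₁, hk]; module⟩

lemma exists_binary_quadratic (s t : MvPolynomial (Fin 3) ℂ) (A B D : ℂ) :
    ∃ f : MvPolynomial (Fin 2) ℂ, f.IsHomogeneous 2 ∧
      A • s ^ 2 + B • (s * t) + D • t ^ 2 = aeval ![s, t] f :=
  ⟨A • X 0 ^ 2 + B • (X 0 * X 1) + D • X 1 ^ 2,
    ((((isHomogeneous_X ℂ 0).pow 2).smul_complex A).add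
      (((isHomogeneous_X ℂ 0).mul (isHomogeneous_X ℂ 1)).smul_complex B)).add
      (((isHomogeneous_X ℂ 1).pow 2).smul_complex D), by simp⟩

/-- **Theorem 2 (homogeneous case).** If `p, q` are linearly independent homogeneous
quadratics in `ℂ[x,y,z]` and there are four pairwise noncollinear vectors
`(αᵢ, βᵢ) ∈ ℂ²` such that each `αᵢ•p + βᵢ•q` is factorizable, then (a) `p` and `q`
have a common linear factor, or (b) `p = f(s,t)`, `q = g(s,t)` for linear forms
`s, t` and bivariate homogeneous quadratics `f, g`; consequently every linear
combination `α•p + β•q` is factorizable. -/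
theorem four_factorizable_combinations_imply_all
    (p q : MvPolynomial (Fin 3) ℂ)
    (hp : p.IsHomogeneous 2) (hq : q.IsHomogeneous 2)
    (hind : LinearIndependent ℂ ![p, q])
    (v : Fin 4 → ℂ × ℂ)
    (hnc : ∀ i j, i ≠ j → (v i).1 * (v j).2 - (v j).1 * (v i).2 ≠ 0)
    (hfac : ∀ i, Factorizable3 ((v i).1 • p + (v i).2 • q)) :
    ((∃ ℓ ℓ₁ ℓ₂ : MvPolynomial (Fin 3) ℂ,
        ℓ.IsHomogeneous 1 ∧ ℓ₁.IsHomogeneous 1 ∧ ℓ₂.IsHomogeneous 1 ∧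
        ℓ ≠ 0 ∧ ℓ₁ ≠ 0 ∧ ℓ₂ ≠ 0 ∧
        p = ℓ * ℓ₁ ∧ q = ℓ * ℓ₂) ∨
     (∃ s t : MvPolynomial (Fin 3) ℂ, ∃ f g : MvPolynomial (Fin 2) ℂ,
        s.IsHomogeneous 1 ∧ t.IsHomogeneous 1 ∧
        f.IsHomogeneous 2 ∧ g.IsHomogeneous 2 ∧
        p = aeval ![s, t] f ∧ q = aeval ![s, t] g)) ∧
    (∀ α β : ℂ, Factorizable3 (α • p + β • q)) := by
  have h := isDegeneratePair_of_four_factorizable hnc hfac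
  refine ⟨?_, h.factorizable3⟩
  rcases h with ⟨ℓ, ℓ₁, ℓ₂, h, h₁, h₂, rfl, rfl⟩ |
    ⟨s, t, hs, ht, ⟨A, B, C, rfl⟩, A', B', C', rfl⟩
  · have hp₀ : ℓ * ℓ₁ ≠ 0 := hind.ne_zero 0
    have hq₀ : ℓ * ℓ₂ ≠ 0 := hind.ne_zero 1
    exact Or.inl ⟨ℓ, ℓ₁, ℓ₂, h, h₁, h₂, left_ne_zero_of_mul hp₀, right_ne_zero_of_mul hp₀,
      right_ne_zero_of_mul hq₀, rfl, rfl⟩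
  · obtain ⟨f, hf, ef⟩ := exists_binary_quadratic s t A B C
    obtain ⟨g, hg, eg⟩ := exists_binary_quadratic s t A' B' C'
    exact Or.inr ⟨s, t, f, g, hs, ht, hf, hg, ef, eg⟩
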